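/- There is no 3-homogeneous access structure Γ on 6 players satisfying monotonicity, no-cloning and no-redundancy that admits a pure QSS state. -/

import Mathlib

open Finset

/-- Monotonicity of an access structure on `n` players (players = `Fin n`). -/
def Monotonic {n : ℕ} (Γ : Finset (Fin n) → Prop) : Prop :=
  ∀ A B : Finset (Fin n), Γ A → A ⊆ B → Γ B

/-- No-cloning: a set is authorized iff its complement is not. -/
def NoCloning {n : ℕ} (Γ : Finset (Fin n) → Prop) : Prop :=
  ∀ A : Finset (Fin n), Γ A ↔ ¬ Γ Aᶜ

/-- `A` is a minimal authorized set of `Γ`. -/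
def IsMinimal {n : ℕ} (Γ : Finset (Fin n) → Prop) (A : Finset (Fin n)) : Prop :=
  Γ A ∧ ∀ B : Finset (Fin n), B ⊂ A → ¬ Γ B

/-- No-redundancy: every player lies in some minimal authorized set. -/
def NoRedundancy {n : ℕ} (Γ : Finset (Fin n) → Prop) : Prop :=
  ∀ i : Fin n, ∃ A : Finset (Fin n), IsMinimal Γ A ∧ i ∈ A

noncomputable section

/-- Combine an assignment on `A` and one on `Aᶜ` into a full bit string. -/
def glue {m : ℕ} (A : Finset (Fin m)) (u : {x // x ∈ A} → Fin 2)
    (w : {x // x ∈ Aᶜ} → Fin 2) : Fin m → Fin 2 :=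
  fun x => if h : x ∈ A then u ⟨x, h⟩ else w ⟨x, Finset.mem_compl.mpr h⟩

/-- Reduced density matrix of the pure state `ψ` on the qubit positions in `A`:
the partial trace over the positions outside `A` of `ψψ†`. -/
def reducedDensity {m : ℕ} (ψ : (Fin m → Fin 2) → ℂ) (A : Finset (Fin m)) :
    Matrix ({x // x ∈ A} → Fin 2) ({x // x ∈ A} → Fin 2) ℂ :=
  fun u v => ∑ w : {x // x ∈ Aᶜ} → Fin 2,
    ψ (glue A u w) * (starRingEnd ℂ) (ψ (glue A v w))

/-- The reduction of `ψ` to `A` is maximally mixed, i.e. equals `2^{-|A|} · I`. -/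
def MaximallyMixed {m : ℕ} (ψ : (Fin m → Fin 2) → ℂ) (A : Finset (Fin m)) : Prop :=
  reducedDensity ψ A =
    ((2 : ℂ) ^ A.card)⁻¹ •
      (1 : Matrix ({x // x ∈ A} → Fin 2) ({x // x ∈ A} → Fin 2) ℂ)

open Classical in
/-- Von Neumann entropy (natural logarithm): sum of `-λ log λ` over the eigenvalues. -/
def vnEntropy {ι : Type} [Fintype ι] [DecidableEq ι] (ρ : Matrix ι ι ℂ) : ℝ :=
  if h : ρ.IsHermitian then ∑ i, Real.negMulLog (h.eigenvalues i) else 0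

/-- Entropy of the reduction of `ψ` to the set `A` of qubit positions. -/
def Sent {m : ℕ} (ψ : (Fin m → Fin 2) → ℂ) (A : Finset (Fin m)) : ℝ :=
  vnEntropy (reducedDensity ψ A)

/-- The qubit positions (in `{0,1,…,n} = Fin (n+1)`, where `0` is the reference qubit)
of a set of players `A ⊆ Fin n`: player `i` holds position `i.succ`. -/
def posOf {n : ℕ} (A : Finset (Fin n)) : Finset (Fin (n + 1)) := A.image Fin.succ

/-- `ψ` is a pure QSS state for the access structure `Γ`: a normalized pure state of
`n+1` qubits (position `0` being the reference qubit `R`) satisfying Recoverability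
`S(R) + S(A) - S(R ∪ A) = 2 log 2` for authorized `A` and Secrecy
`S(R) + S(B) - S(R ∪ B) = 0` for unauthorized `B`. -/
structure IsPureQSSState {n : ℕ} (Γ : Finset (Fin n) → Prop)
    (ψ : (Fin (n + 1) → Fin 2) → ℂ) : Prop where
  normalized : ∑ x : Fin (n + 1) → Fin 2, ‖ψ x‖ ^ 2 = 1
  recover : ∀ A : Finset (Fin n), Γ A →
    Sent ψ {0} + Sent ψ (posOf A) - Sent ψ (insert 0 (posOf A)) = 2 * Real.log 2
  secrecy : ∀ B : Finset (Fin n), ¬ Γ B →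
    Sent ψ {0} + Sent ψ (posOf B) - Sent ψ (insert 0 (posOf B)) = 0

end

section QMat

open Matrix Kronecker ComplexOrder

theorem vn_roots {ι : Type} [Fintype ι] [DecidableEq ι] {ρ : Matrix ι ι ℂ} (h : ρ.IsHermitian) :
    vnEntropy ρ = (ρ.charpoly.roots.map (fun z : ℂ => Real.negMulLog z.re)).sum := by
  rw [h.roots_charpoly_eq_eigenvalues, vnEntropy, dif_pos h]
  simp [Finset.sum_map_val]

theorem vn_congr {ι κ : Type} [Fintype ι] [DecidableEq ι] [Fintype κ] [DecidableEq κ]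
    {ρ : Matrix ι ι ℂ} {σ : Matrix κ κ ℂ} (h : ρ.IsHermitian) (h' : σ.IsHermitian)
    (hc : ρ.charpoly = σ.charpoly) : vnEntropy ρ = vnEntropy σ := by
  rw [vn_roots h, vn_roots h', hc]

theorem vn_mul_comm {ι κ : Type} [Fintype ι] [DecidableEq ι] [Fintype κ] [DecidableEq κ]
    (P : Matrix ι κ ℂ) : vnEntropy (P * Pᴴ) = vnEntropy (Pᴴ * P) := by
  rw [vn_roots (isHermitian_mul_conjTranspose_self P),
    vn_roots (isHermitian_conjTranspose_mul_self P)]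
  have h := congrArg Polynomial.roots (charpoly_mul_comm' P Pᴴ)
  have hX : ∀ k : ℕ, (Polynomial.X : Polynomial ℂ) ^ k ≠ 0 :=
    fun k => pow_ne_zero _ Polynomial.X_ne_zero
  rw [Polynomial.roots_mul (mul_ne_zero (hX _) (charpoly_monic _).ne_zero),
    Polynomial.roots_mul (mul_ne_zero (hX _) (charpoly_monic _).ne_zero)] at h
  have h2 := congrArg (fun s => (s.map (fun z : ℂ => Real.negMulLog z.re)).sum) h
  simpa [Multiset.map_nsmul, Multiset.sum_nsmul] using h2

theorem vn_diagonal {ι : Type} [Fintype ι] [DecidableEq ι] (d : ι → ℝ) :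
    vnEntropy (diagonal (fun i => (d i : ℂ))) = ∑ i, Real.negMulLog (d i) := by
  have h : (diagonal (fun i => (d i : ℂ))).IsHermitian := by
    apply isHermitian_diagonal_of_self_adjoint
    ext i; simp
  rw [vn_roots h, charpoly_diagonal, Polynomial.roots_prod]
  · simp [Finset.sum_map_val]
  · simp [Finset.prod_ne_zero_iff, Polynomial.X_sub_C_ne_zero]

theorem schur_aux {ι : Type} [Fintype ι] [DecidableEq ι] {M : Matrix ι ι ℂ} (h : M.PosSemidef) :
    vnEntropy M ≤ ∑ i, Real.negMulLog (M i i).re ∧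
    ((∑ i, Real.negMulLog (M i i).re ≤ vnEntropy M) → ∀ i j, i ≠ j → M i j = 0) := by
  classical
  have hH := h.1
  set U : Matrix ι ι ℂ := (hH.eigenvectorUnitary : Matrix ι ι ℂ) with hU
  set l := hH.eigenvalues with hl
  have hl0 : ∀ i, 0 ≤ l i := h.eigenvalues_nonneg
  have hUU : U * star U = 1 := Unitary.coe_mul_star_self hH.eigenvectorUnitary
  have hUU' : star U * U = 1 := Unitary.coe_star_mul_self hH.eigenvectorUnitary
  have hM : M = U * diagonal (fun i => (l i : ℂ)) * star U := by
    have := hH.spectral_theorem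
    rw [Unitary.conjStarAlgAut_apply] at this
    exact this
  have hMij : ∀ i j, M i j = ∑ k, U i k * (l k : ℂ) * star (U j k) := by
    intro i j
    conv_lhs => rw [hM]
    rw [mul_apply]
    simp [mul_diagonal]
  have hUij : ∀ i j, ∑ k, U i k * star (U j k) = (1 : Matrix ι ι ℂ) i j := by
    intro i j
    rw [← hUU, mul_apply]; simp
  have hUij' : ∀ i j, ∑ k, star (U k i) * U k j = (1 : Matrix ι ι ℂ) i j := by
    intro i j
    rw [← hUU', mul_apply]; simp
  have hrow : ∀ i, ∑ k, ‖U i k‖ ^ 2 = 1 := by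
    intro i
    have := hUij i i
    simp only [one_apply_eq] at this
    have h2 : ((∑ k, ‖U i k‖ ^ 2 : ℝ) : ℂ) = 1 := by
      rw [← this]; push_cast
      exact Finset.sum_congr rfl fun k _ => (Complex.mul_conj' _).symm
    exact_mod_cast h2
  have hcol : ∀ k, ∑ i, ‖U i k‖ ^ 2 = 1 := by
    intro i
    have := hUij' i i
    simp only [one_apply_eq] at this
    have h2 : ((∑ k, ‖U k i‖ ^ 2 : ℝ) : ℂ) = 1 := by
      rw [← this]; push_cast
      exact Finset.sum_congr rfl fun k _ => (Complex.conj_mul' _).symm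
    exact_mod_cast h2
  have hdiag : ∀ i, (M i i).re = ∑ k, ‖U i k‖ ^ 2 • l k := by
    intro i
    have h2 : M i i = ((∑ k, ‖U i k‖ ^ 2 • l k : ℝ) : ℂ) := by
      rw [hMij]; push_cast
      refine Finset.sum_congr rfl fun k _ => ?_
      rw [mul_right_comm]
      simp only [smul_eq_mul]
      push_cast
      congr 1
      exact Complex.mul_conj' _
    rw [h2, Complex.ofReal_re]
  have hS : vnEntropy M = ∑ i, ∑ k, ‖U i k‖ ^ 2 • Real.negMulLog (l k) := by
    rw [vnEntropy, dif_pos hH, Finset.sum_comm]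
    refine Finset.sum_congr rfl fun k _ => ?_
    rw [← Finset.sum_smul, hcol, one_smul]
  have hJ : ∀ i, ∑ k, ‖U i k‖ ^ 2 • Real.negMulLog (l k) ≤ Real.negMulLog (M i i).re := by
    intro i
    rw [hdiag]
    exact Real.concaveOn_negMulLog.le_map_sum (fun _ _ => by positivity) (hrow i)
      (fun k _ => hl0 k)
  refine ⟨hS ▸ Finset.sum_le_sum fun i _ => hJ i, fun hle i j hij => ?_⟩
  have heq : ∑ i, ∑ k, ‖U i k‖ ^ 2 • Real.negMulLog (l k) = ∑ i, Real.negMulLog (M i i).re :=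
    le_antisymm (Finset.sum_le_sum fun i _ => hJ i) (hS ▸ hle)
  have h1 := (Finset.sum_eq_sum_iff_of_le (fun i _ => hJ i)).1 heq i (Finset.mem_univ _)
  have h2 := (Real.strictConcaveOn_negMulLog.map_sum_eq_iff' (t := Finset.univ)
    (w := fun k => ‖U i k‖ ^ 2) (p := l)
    (fun _ _ => by positivity) (hrow i) (fun k _ => hl0 k)).1 (by rw [← hdiag]; exact h1.symm)
  have h3 : ∀ k, U i k * (l k : ℂ) = U i k * ((M i i).re : ℂ) := by
    intro k
    by_cases hk : U i k = 0
    · simp [hk]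
    · have := h2 k (Finset.mem_univ _) (by simpa using hk)
      rw [this, hdiag]
  rw [hMij]
  have h4 : ∀ k, U i k * (l k : ℂ) * star (U j k) = U i k * star (U j k) * ((M i i).re : ℂ) := by
    intro k; rw [h3]; ring
  rw [Finset.sum_congr rfl (fun k _ => h4 k), ← Finset.sum_mul, hUij, one_apply_ne hij, zero_mul]

theorem eta_two {x y : ℝ} (hx : 0 ≤ x) (hy : 0 ≤ y) :
    Real.negMulLog x + Real.negMulLog y ≤ (x + y) * Real.log 2 + Real.negMulLog (x + y) ∧
    ((x + y) * Real.log 2 + Real.negMulLog (x + y) ≤ Real.negMulLog x + Real.negMulLog y →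
      x = y) := by
  have key : 2 * Real.negMulLog ((x + y) / 2) = (x + y) * Real.log 2 + Real.negMulLog (x + y) := by
    rcases eq_or_lt_of_le (add_nonneg hx hy) with h | h
    · rw [← h]; simp
    · unfold Real.negMulLog
      rw [Real.log_div h.ne' two_ne_zero]; ring
  rw [← key]
  constructor
  · have := Real.concaveOn_negMulLog.2 (Set.mem_Ici.2 hx) (Set.mem_Ici.2 hy)
      (by norm_num : (0:ℝ) ≤ 1/2) (by norm_num : (0:ℝ) ≤ 1/2) (by norm_num)
    simp only [smul_eq_mul] at this
    rw [show 1/2 * x + 1/2 * y = (x + y)/2 by ring] at this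
    linarith
  · intro hle
    by_contra hne
    have := Real.strictConcaveOn_negMulLog.2 (Set.mem_Ici.2 hx) (Set.mem_Ici.2 hy) hne
      (by norm_num : (0:ℝ) < 1/2) (by norm_num : (0:ℝ) < 1/2) (by norm_num)
    simp only [smul_eq_mul] at this
    rw [show 1/2 * x + 1/2 * y = (x + y)/2 by ring] at this
    linarith

/-- block of a matrix on a qubit times something -/
def blk {β : Type} (M : Matrix (Fin 2 × β) (Fin 2 × β) ℂ) (a a' : Fin 2) : Matrix β β ℂ :=
  fun b b' => M (a, b) (a', b')

theorem conj_blk {β : Type} [Fintype β] [DecidableEq β] (M : Matrix (Fin 2 × β) (Fin 2 × β) ℂ)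
    (U W : Matrix β β ℂ) (a a' : Fin 2) :
    blk (((1 : Matrix (Fin 2) (Fin 2) ℂ) ⊗ₖ W) * M * ((1 : Matrix (Fin 2) (Fin 2) ℂ) ⊗ₖ U)) a a' =
      W * blk M a a' * U := by
  ext b b'
  simp [blk, mul_apply, Fintype.sum_prod_type, one_apply, Finset.sum_mul, ite_mul,
    Finset.sum_ite_eq, -Fin.sum_univ_two]

theorem diagU {β : Type} [Fintype β] [DecidableEq β] {N : Matrix β β ℂ} (h : N.PosSemidef) :
    ∃ (U : Matrix β β ℂ) (l : β → ℝ), U * star U = 1 ∧ star U * U = 1 ∧ (∀ b, 0 ≤ l b) ∧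
      star U * N * U = diagonal (fun i => (l i : ℂ)) ∧
      vnEntropy N = ∑ b, Real.negMulLog (l b) ∧ N.trace = ∑ b, (l b : ℂ) := by
  have hH := h.1
  refine ⟨hH.eigenvectorUnitary, hH.eigenvalues, Unitary.coe_mul_star_self _,
    Unitary.coe_star_mul_self _, h.eigenvalues_nonneg, ?_, ?_, ?_⟩
  · have := hH.conjStarAlgAut_star_eigenvectorUnitary
    rw [Unitary.conjStarAlgAut_star_apply] at this
    exact this
  · rw [vnEntropy, dif_pos hH]
  · exact hH.trace_eq_sum_eigenvalues

theorem conjK {β : Type} [Fintype β] [DecidableEq β] {M : Matrix (Fin 2 × β) (Fin 2 × β) ℂ}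
    (h : M.PosSemidef) {U : Matrix β β ℂ} (h1 : U * star U = 1) :
    (((1 : Matrix (Fin 2) (Fin 2) ℂ) ⊗ₖ (star U)) * M *
      ((1 : Matrix (Fin 2) (Fin 2) ℂ) ⊗ₖ U)).PosSemidef ∧
    vnEntropy (((1 : Matrix (Fin 2) (Fin 2) ℂ) ⊗ₖ (star U)) * M *
      ((1 : Matrix (Fin 2) (Fin 2) ℂ) ⊗ₖ U)) = vnEntropy M := by
  have hstar : (1 : Matrix (Fin 2) (Fin 2) ℂ) ⊗ₖ (star U) =
      ((1 : Matrix (Fin 2) (Fin 2) ℂ) ⊗ₖ U)ᴴ := by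
    rw [conjTranspose_kronecker]; simp [star_eq_conjTranspose]
  have hp : (((1 : Matrix (Fin 2) (Fin 2) ℂ) ⊗ₖ (star U)) * M *
      ((1 : Matrix (Fin 2) (Fin 2) ℂ) ⊗ₖ U)).PosSemidef := by
    rw [hstar]; exact h.conjTranspose_mul_mul_same _
  refine ⟨hp, vn_congr hp.1 h.1 ?_⟩
  rw [charpoly_mul_comm, ← mul_assoc, ← mul_kronecker_mul, h1]
  simp

theorem sub_aux {β : Type} [Fintype β] [DecidableEq β] {M : Matrix (Fin 2 × β) (Fin 2 × β) ℂ}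
    {N : Matrix β β ℂ} (h : M.PosSemidef) (hN : N.PosSemidef) (hMN : blk M 0 0 + blk M 1 1 = N)
    (ht : N.trace = 1) :
    vnEntropy M ≤ Real.log 2 + vnEntropy N ∧
    (Real.log 2 + vnEntropy N ≤ vnEntropy M →
      ∀ a a', blk M a a' = if a = a' then (1 / 2 : ℂ) • N else 0) := by
  obtain ⟨U, l, h1, h2, hl, hD, hS, hT⟩ := diagU hN
  obtain ⟨hp, he⟩ := conjK h h1
  have hb := conj_blk M U (star U)
  set M' := ((1 : Matrix (Fin 2) (Fin 2) ℂ) ⊗ₖ (star U)) * M *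
      ((1 : Matrix (Fin 2) (Fin 2) ℂ) ⊗ₖ U) with hM'
  obtain ⟨hs1, hs2⟩ := schur_aux hp
  rw [he] at hs1 hs2
  have hsum : blk M' 0 0 + blk M' 1 1 = diagonal (fun i => (l i : ℂ)) := by
    rw [hb, hb, ← hD, ← hMN]; simp [mul_add, add_mul]
  have hx : ∀ a b, 0 ≤ (M' (a, b) (a, b)).re := fun a b => by
    have := hp.diag_nonneg (i := (a, b))
    exact (Complex.le_def.1 this).1
  have hsb : ∀ b, (M' (0, b) (0, b)).re + (M' (1, b) (1, b)).re = l b := by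
    intro b
    have := congrArg Complex.re (congrFun (congrFun hsum b) b)
    simpa [blk] using this
  have hlsum : ∑ b, l b = 1 := by
    rw [hT] at ht; exact_mod_cast ht
  have hR : Real.log 2 + vnEntropy N = ∑ b, (l b * Real.log 2 + Real.negMulLog (l b)) := by
    rw [Finset.sum_add_distrib, ← Finset.sum_mul, hlsum, hS, one_mul]
  have hdd : ∑ i, Real.negMulLog (M' i i).re =
      ∑ b, (Real.negMulLog (M' (0, b) (0, b)).re + Real.negMulLog (M' (1, b) (1, b)).re) := by
    rw [Fintype.sum_prod_type, Fin.sum_univ_two, Finset.sum_add_distrib]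
  have hper : ∀ b, Real.negMulLog (M' (0, b) (0, b)).re + Real.negMulLog (M' (1, b) (1, b)).re ≤
      l b * Real.log 2 + Real.negMulLog (l b) := by
    intro b; rw [← hsb]; exact (eta_two (hx _ _) (hx _ _)).1
  have hle : ∑ i, Real.negMulLog (M' i i).re ≤ Real.log 2 + vnEntropy N := by
    rw [hdd, hR]; exact Finset.sum_le_sum fun b _ => hper b
  refine ⟨hs1.trans hle, fun hge => ?_⟩
  have hoff := hs2 (hle.trans hge)
  have heq := le_antisymm hle (hge.trans hs1)
  rw [hdd, hR] at heq
  have hb2 : ∀ b, (M' (0, b) (0, b)).re = (M' (1, b) (1, b)).re := by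
    intro b
    have := (Finset.sum_eq_sum_iff_of_le (fun i _ => hper i)).1 heq b (Finset.mem_univ _)
    rw [← hsb] at this
    exact (eta_two (hx _ _) (hx _ _)).2 this.ge
  have hre : ∀ i, M' i i = ((M' i i).re : ℂ) := fun i => (hp.1.coe_re_apply_self i).symm
  have hblk : ∀ a a', blk M' a a' =
      if a = a' then (1 / 2 : ℂ) • diagonal (fun i => (l i : ℂ)) else 0 := by
    intro a a'
    ext b b'
    by_cases haa : a = a'
    · subst haa
      by_cases hbb : b = b'
      · subst hbb
        have hval : (M' (a, b) (a, b)).re = 1 / 2 * l b := by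
          have e1 := hsb b
          have e2 := hb2 b
          fin_cases a <;> simp <;> linarith
        simp only [blk, if_true, Matrix.smul_apply, diagonal_apply_eq, smul_eq_mul]
        rw [hre, hval]; push_cast; ring
      · have : M' (a, b) (a, b') = 0 := hoff _ _ (by simpa using hbb)
        simp [blk, this, hbb]
    · have : M' (a, b) (a', b') = 0 := hoff _ _ (by simp [haa])
      simp [blk, this, haa]
  intro a a'
  have hback : blk M a a' = U * blk M' a a' * star U := by
    rw [hb]
    calc blk M a a' = (U * star U) * blk M a a' * (U * star U) := by rw [h1]; simp
      _ = _ := by simp only [mul_assoc]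
  rw [hback, hblk]
  split_ifs with haa
  · rw [← hD]
    have : U * (star U * N * U) * star U = (U * star U) * N * (U * star U) := by
      simp only [mul_assoc]
    rw [mul_smul_comm, smul_mul_assoc, this, h1]; simp
  · simp

theorem prod_ent {β : Type} [Fintype β] [DecidableEq β] {M : Matrix (Fin 2 × β) (Fin 2 × β) ℂ}
    {N : Matrix β β ℂ} (h : M.PosSemidef) (hN : N.PosSemidef)
    (hM : ∀ a a', blk M a a' = if a = a' then (1 / 2 : ℂ) • N else 0)
    (ht : N.trace = 1) : vnEntropy M = Real.log 2 + vnEntropy N := by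
  obtain ⟨U, l, h1, h2, hl, hD, hS, hT⟩ := diagU hN
  obtain ⟨hp, he⟩ := conjK h h1
  have hb := conj_blk M U (star U)
  set M' := ((1 : Matrix (Fin 2) (Fin 2) ℂ) ⊗ₖ (star U)) * M *
      ((1 : Matrix (Fin 2) (Fin 2) ℂ) ⊗ₖ U) with hM'
  have hlsum : ∑ b, l b = 1 := by
    rw [hT] at ht; exact_mod_cast ht
  have hd : M' = diagonal (fun i : Fin 2 × β => ((l i.2 / 2 : ℝ) : ℂ)) := by
    ext ⟨a, b⟩ ⟨a', b'⟩
    have := congrFun (congrFun (hb a a') b) b'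
    rw [hM] at this
    change M' (a, b) (a', b') = _ at this
    rw [this]
    by_cases haa : a = a'
    · subst haa
      rw [if_pos rfl, mul_smul_comm, smul_mul_assoc, hD]
      by_cases hbb : b = b'
      · subst hbb; simp; ring
      · simp [hbb]
    · simp [haa]
  rw [← he, hd, vn_diagonal (fun i : Fin 2 × β => l i.2 / 2), Fintype.sum_prod_type,
    Fin.sum_univ_two, hS]
  have hper : ∀ b, Real.negMulLog (l b / 2) + Real.negMulLog (l b / 2) =
      l b * Real.log 2 + Real.negMulLog (l b) := by
    intro b
    rcases eq_or_lt_of_le (hl b) with h | h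
    · rw [← h]; simp
    · unfold Real.negMulLog
      rw [Real.log_div h.ne' two_ne_zero]; ring
  rw [← Finset.sum_add_distrib]
  simp only [hper]
  rw [Finset.sum_add_distrib, ← Finset.sum_mul, hlsum, one_mul]

end QMat

section QState

open Matrix ComplexOrder

def Gm {m : ℕ} (ψ : (Fin m → Fin 2) → ℂ) (A : Finset (Fin m)) (x y : Fin m → Fin 2) : ℂ :=
  ∑ z : Fin m → Fin 2, if (∀ k ∈ A, z k = x k) then
    ψ z * (starRingEnd ℂ) (ψ (A.piecewise y z)) else 0

theorem rd_eq {m : ℕ} (ψ : (Fin m → Fin 2) → ℂ) (A : Finset (Fin m)) (x y : Fin m → Fin 2) :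
    reducedDensity ψ A (fun k => x k) (fun k => y k) = Gm ψ A x y := by
  unfold reducedDensity Gm
  rw [← Finset.sum_filter]
  refine Finset.sum_nbij' (fun w => glue A (fun k => x k) w) (fun z k => z k) ?_ ?_ ?_ ?_ ?_
  · intro w _
    simp only [Finset.mem_filter, Finset.mem_univ, true_and]
    intro k hk
    simp [glue, hk]
  · intros; simp
  · intro w _
    funext k
    have := Finset.mem_compl.1 k.2
    simp [glue, this]
  · intro z hz
    simp only [Finset.mem_filter, Finset.mem_univ, true_and] at hz
    funext k
    by_cases hk : k ∈ A
    · simp [glue, hk, hz k hk]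
    · simp [glue, hk]
  · intro w _
    congr 3
    funext k
    by_cases hk : k ∈ A <;> simp [glue, hk]

theorem Gm_trace {m : ℕ} (ψ : (Fin m → Fin 2) → ℂ) (A : Finset (Fin m)) (i : Fin m) (hi : i ∉ A)
    (x y : Fin m → Fin 2) :
    Gm ψ A x y = ∑ a : Fin 2, Gm ψ (insert i A) (Function.update x i a) (Function.update y i a) := by
  unfold Gm
  rw [Finset.sum_comm]
  refine Finset.sum_congr rfl fun z _ => ?_
  have hcond : ∀ a, (∀ k ∈ insert i A, z k = Function.update x i a k) ↔
      (z i = a ∧ ∀ k ∈ A, z k = x k) := by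
    intro a
    rw [Finset.forall_mem_insert, Function.update_self]
    refine and_congr_right fun _ => forall₂_congr fun k hk => ?_
    rw [Function.update_of_ne (show k ≠ i from fun h => hi (h ▸ hk))]
  rw [Finset.sum_eq_single (z i)]
  · simp only [hcond, true_and]
    have : (insert i A).piecewise (Function.update y i (z i)) z = A.piecewise y z := by
      funext k
      by_cases hki : k = i
      · subst hki; simp [hi]
      · by_cases hk : k ∈ A <;> simp [hk, hki]
    rw [this]
  · intro a _ ha
    rw [if_neg]
    rw [hcond]
    exact fun h => ha h.1.symm
  · simp

theorem Gm_congr {m : ℕ} (ψ : (Fin m → Fin 2) → ℂ) (A : Finset (Fin m)) {x y x' y' : Fin m → Fin 2}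
    (hx : ∀ k ∈ A, x k = x' k) (hy : ∀ k ∈ A, y k = y' k) : Gm ψ A x y = Gm ψ A x' y' := by
  rw [← rd_eq, ← rd_eq]
  congr 1
  · funext k; exact hx k k.2
  · funext k; exact hy k k.2

def ext0 {m : ℕ} {A : Finset (Fin m)} (u : {x // x ∈ A} → Fin 2) : Fin m → Fin 2 :=
  fun k => if h : k ∈ A then u ⟨k, h⟩ else 0

theorem rd_eq' {m : ℕ} (ψ : (Fin m → Fin 2) → ℂ) (A : Finset (Fin m))
    (u v : {x // x ∈ A} → Fin 2) : reducedDensity ψ A u v = Gm ψ A (ext0 u) (ext0 v) := by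
  rw [← rd_eq]
  congr 1 <;> (funext k; simp [ext0])

def amp {m : ℕ} (ψ : (Fin m → Fin 2) → ℂ) (A : Finset (Fin m)) :
    Matrix ({x // x ∈ A} → Fin 2) ({x // x ∈ Aᶜ} → Fin 2) ℂ := fun u w => ψ (glue A u w)

theorem rd_amp {m : ℕ} (ψ : (Fin m → Fin 2) → ℂ) (A : Finset (Fin m)) :
    reducedDensity ψ A = amp ψ A * (amp ψ A)ᴴ := by
  ext u v
  simp [reducedDensity, amp, mul_apply]

theorem rd_psd {m : ℕ} (ψ : (Fin m → Fin 2) → ℂ) (A : Finset (Fin m)) :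
    (reducedDensity ψ A).PosSemidef := by
  rw [rd_amp]; exact posSemidef_self_mul_conjTranspose _

def complE {m : ℕ} (A : Finset (Fin m)) :
    ({x // x ∈ A} → Fin 2) ≃ ({x // x ∈ Aᶜᶜ} → Fin 2) :=
  Equiv.arrowCongr (Equiv.subtypeEquivRight (fun x => by simp)) (Equiv.refl _)

theorem glue_compl {m : ℕ} (A : Finset (Fin m)) (u : {x // x ∈ A} → Fin 2)
    (w : {x // x ∈ Aᶜ} → Fin 2) : glue Aᶜ w (complE A u) = glue A u w := by
  funext k
  by_cases hk : k ∈ A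
  · simp [glue, hk, complE, Equiv.subtypeEquivRight]
    rfl
  · simp [glue, hk]

theorem Sent_compl {m : ℕ} (ψ : (Fin m → Fin 2) → ℂ) (A : Finset (Fin m)) :
    Sent ψ Aᶜ = Sent ψ A := by
  unfold Sent
  have h1 : reducedDensity ψ Aᶜ = ((amp ψ A)ᴴ * amp ψ A)ᵀ := by
    ext u v
    rw [reducedDensity, ← (complE A).sum_comp]
    simp only [glue_compl, transpose_apply, mul_apply, conjTranspose_apply, amp]
    exact Finset.sum_congr rfl fun w _ => mul_comm _ _
  rw [vn_congr (σ := (amp ψ A)ᴴ * amp ψ A) (rd_psd ψ Aᶜ).1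
    (isHermitian_conjTranspose_mul_self _) (by rw [h1, charpoly_transpose]), ← vn_mul_comm, rd_amp]

theorem rd_trace {m : ℕ} (ψ : (Fin m → Fin 2) → ℂ) (hψ : ∑ x, ‖ψ x‖ ^ 2 = 1)
    (A : Finset (Fin m)) : (reducedDensity ψ A).trace = 1 := by
  have h1 : (reducedDensity ψ A).trace = ∑ p : ({x // x ∈ A} → Fin 2) × ({x // x ∈ Aᶜ} → Fin 2),
      ψ (glue A p.1 p.2) * (starRingEnd ℂ) (ψ (glue A p.1 p.2)) := by
    rw [Fintype.sum_prod_type]; rfl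
  have h2 : ∑ p : ({x // x ∈ A} → Fin 2) × ({x // x ∈ Aᶜ} → Fin 2),
      ψ (glue A p.1 p.2) * (starRingEnd ℂ) (ψ (glue A p.1 p.2)) =
      ∑ x, ψ x * (starRingEnd ℂ) (ψ x) := by
    refine Finset.sum_nbij' (fun p => glue A p.1 p.2) (fun z => (fun k => z k, fun k => z k))
      ?_ ?_ ?_ ?_ ?_
    · intros; simp
    · intros; simp
    · rintro ⟨u, w⟩ _
      ext k
      · simp [glue]
      · have := Finset.mem_compl.1 k.2
        simp [glue, this]
    · intro z _
      funext k
      by_cases hk : k ∈ A <;> simp [glue, hk]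
    · intros; rfl
  rw [h1, h2]
  have : ((∑ x, ‖ψ x‖ ^ 2 : ℝ) : ℂ) = 1 := by rw [hψ]; simp
  rw [← this]; push_cast
  exact Finset.sum_congr rfl fun k _ => Complex.mul_conj' _

def insE {m : ℕ} (i : Fin m) (B : Finset (Fin m)) (hi : i ∉ B) :
    ({x // x ∈ insert i B} → Fin 2) ≃ Fin 2 × ({x // x ∈ B} → Fin 2) where
  toFun u := (u ⟨i, Finset.mem_insert_self _ _⟩, fun k => u ⟨k, Finset.mem_insert_of_mem k.2⟩)
  invFun p := fun k => Function.update (ext0 p.2) i p.1 k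
  left_inv u := by
    funext ⟨k, hk⟩
    by_cases hki : k = i
    · subst hki; simp
    · have : k ∈ B := (Finset.mem_insert.1 hk).resolve_left hki
      simp [hki, ext0, this]
  right_inv p := by
    ext k
    · simp
    · have : (k : Fin m) ≠ i := fun h => hi (h ▸ k.2)
      simp [ext0, this]

def rdI {m : ℕ} (ψ : (Fin m → Fin 2) → ℂ) (i : Fin m) (B : Finset (Fin m)) (hi : i ∉ B) :
    Matrix (Fin 2 × ({x // x ∈ B} → Fin 2)) (Fin 2 × ({x // x ∈ B} → Fin 2)) ℂ :=
  reindex (insE i B hi) (insE i B hi) (reducedDensity ψ (insert i B))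

theorem rdI_apply {m : ℕ} (ψ : (Fin m → Fin 2) → ℂ) (i : Fin m) (B : Finset (Fin m)) (hi : i ∉ B)
    (a a' : Fin 2) (u v : {x // x ∈ B} → Fin 2) :
    rdI ψ i B hi (a, u) (a', v) = Gm ψ (insert i B) (Function.update (ext0 u) i a)
      (Function.update (ext0 v) i a') := by
  rw [← rd_eq]; rfl

theorem rdI_psd {m : ℕ} (ψ : (Fin m → Fin 2) → ℂ) (i : Fin m) (B : Finset (Fin m)) (hi : i ∉ B) :
    (rdI ψ i B hi).PosSemidef := (rd_psd ψ _).submatrix _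

theorem rdI_ent {m : ℕ} (ψ : (Fin m → Fin 2) → ℂ) (i : Fin m) (B : Finset (Fin m)) (hi : i ∉ B) :
    vnEntropy (rdI ψ i B hi) = Sent ψ (insert i B) :=
  vn_congr (rdI_psd ψ i B hi).1 (rd_psd ψ _).1 (charpoly_reindex _ _)

theorem rdI_sum {m : ℕ} (ψ : (Fin m → Fin 2) → ℂ) (i : Fin m) (B : Finset (Fin m)) (hi : i ∉ B) :
    blk (rdI ψ i B hi) 0 0 + blk (rdI ψ i B hi) 1 1 = reducedDensity ψ B := by
  ext u v
  rw [Matrix.add_apply, rd_eq', Gm_trace ψ B i hi, Fin.sum_univ_two]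
  simp only [blk, rdI_apply]

/-- qubit `i` is maximally mixed and uncorrelated with `B` -/
def Dec {m : ℕ} (ψ : (Fin m → Fin 2) → ℂ) (i : Fin m) (B : Finset (Fin m)) : Prop :=
  ∀ x y, Gm ψ (insert i B) x y = if x i = y i then (1 / 2 : ℂ) * Gm ψ B x y else 0

theorem Sent_insert_le {m : ℕ} (ψ : (Fin m → Fin 2) → ℂ) (hψ : ∑ x, ‖ψ x‖ ^ 2 = 1)
    (i : Fin m) (B : Finset (Fin m)) (hi : i ∉ B) :
    Sent ψ (insert i B) ≤ Real.log 2 + Sent ψ B := by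
  rw [← rdI_ent ψ i B hi]
  exact (sub_aux (rdI_psd ψ i B hi) (rd_psd ψ B) (rdI_sum ψ i B hi) (rd_trace ψ hψ B)).1

theorem Dec_of_eq {m : ℕ} (ψ : (Fin m → Fin 2) → ℂ) (hψ : ∑ x, ‖ψ x‖ ^ 2 = 1)
    (i : Fin m) (B : Finset (Fin m)) (hi : i ∉ B)
    (h : Sent ψ (insert i B) = Real.log 2 + Sent ψ B) : Dec ψ i B := by
  rw [← rdI_ent ψ i B hi] at h
  have := (sub_aux (rdI_psd ψ i B hi) (rd_psd ψ B) (rdI_sum ψ i B hi) (rd_trace ψ hψ B)).2 h.ge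
  intro x y
  have h2 := congrFun (congrFun (this (x i) (y i)) (fun k => x k)) (fun k => y k)
  have hne : ∀ k ∈ B, k ≠ i := fun k hk h => hi (h ▸ hk)
  have hc : ∀ z : Fin m → Fin 2, ∀ k ∈ insert i B, z k = Function.update
      (ext0 (A := B) (fun k => z k)) i (z i) k := by
    intro z k hk
    by_cases hki : k = i
    · subst hki; simp
    · have : k ∈ B := (Finset.mem_insert.1 hk).resolve_left hki
      simp [hki, ext0, this]
  rw [Gm_congr ψ (insert i B) (hc x) (hc y), ← rdI_apply ψ i B hi]
  change rdI ψ i B hi _ _ = _ at h2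
  rw [h2, ← rd_eq]
  split_ifs <;> simp

theorem Dec_ent {m : ℕ} (ψ : (Fin m → Fin 2) → ℂ) (hψ : ∑ x, ‖ψ x‖ ^ 2 = 1)
    (i : Fin m) (B : Finset (Fin m)) (hi : i ∉ B) (h : Dec ψ i B) :
    Sent ψ (insert i B) = Real.log 2 + Sent ψ B := by
  rw [← rdI_ent ψ i B hi]
  refine prod_ent (rdI_psd ψ i B hi) (rd_psd ψ B) ?_ (rd_trace ψ hψ B)
  intro a a'
  ext u v
  have hne : ∀ k ∈ B, k ≠ i := fun k hk h => hi (h ▸ hk)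
  rw [blk, rdI_apply, h, Function.update_self, Function.update_self,
    Gm_congr ψ B (x' := ext0 u) (y' := ext0 v)
      (fun k hk => Function.update_of_ne (hne k hk) _ _)
      (fun k hk => Function.update_of_ne (hne k hk) _ _), ← rd_eq']
  split_ifs <;> simp

theorem Dec_step {m : ℕ} (ψ : (Fin m → Fin 2) → ℂ) (i j : Fin m) (C : Finset (Fin m))
    (hij : i ≠ j) (hj : j ∉ C) (h : Dec ψ i (insert j C)) : Dec ψ i C := by
  intro x y
  rw [Gm_trace ψ (insert i C) j (by simp [hij.symm, hj])]
  rw [Gm_trace ψ C j hj x y, Finset.mul_sum]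
  rw [Finset.insert_comm]
  simp only [h _ _, Function.update_of_ne hij]
  split_ifs <;> simp

theorem Dec_mono {m : ℕ} (ψ : (Fin m → Fin 2) → ℂ) (i : Fin m) (C D : Finset (Fin m))
    (hi : i ∉ D) (h : Dec ψ i (D ∪ C)) : Dec ψ i C := by
  induction D using Finset.induction_on with
  | empty => simpa using h
  | insert j D hj ih =>
    simp only [Finset.mem_insert, not_or] at hi
    rw [Finset.insert_union] at h
    by_cases hjC : j ∈ D ∪ C
    · rw [Finset.insert_eq_of_mem hjC] at h
      exact ih hi.2 h
    · exact ih hi.2 (Dec_step ψ i j _ hi.1 hjC h)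

end QState

theorem posOf_compl {n : ℕ} (A : Finset (Fin n)) : (posOf A)ᶜ = insert 0 (posOf Aᶜ) := by
  ext k
  refine Fin.cases ?_ (fun j => ?_) k <;> simp [posOf]

theorem posOf_insert {n : ℕ} (i : Fin n) (A : Finset (Fin n)) :
    posOf (insert i A) = insert i.succ (posOf A) := by simp [posOf]

theorem mem_posOf {n : ℕ} (i : Fin n) (A : Finset (Fin n)) : i.succ ∈ posOf A ↔ i ∈ A := by
  simp [posOf]

theorem exists_min {n : ℕ} (Γ : Finset (Fin n) → Prop) (A : Finset (Fin n)) (h : Γ A) :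
    ∃ B, B ⊆ A ∧ IsMinimal Γ B := by
  induction A using Finset.strongInduction with
  | H A ih =>
    by_cases hm : ∃ B, B ⊂ A ∧ Γ B
    · obtain ⟨B, hB, hΓ⟩ := hm
      obtain ⟨C, hC, hCm⟩ := ih B hB hΓ
      exact ⟨C, hC.trans hB.1, hCm⟩
    · push Not at hm
      exact ⟨A, Finset.Subset.refl _, h, hm⟩

theorem comb (Γ : Finset (Fin 6) → Prop) (s : Finset (Fin 6) → ℝ) (L : ℝ) (hL : 0 < L)
    (Pr : Fin 6 → Finset (Fin 6) → Prop)
    (hnc : NoCloning Γ) (hnr : NoRedundancy Γ)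
    (h3 : ∀ A : Finset (Fin 6), IsMinimal Γ A → A.card = 3)
    (F1 : ∀ B, ¬ Γ B → s Bᶜ = L + s B)
    (F2 : ∀ i B, i ∉ B → s (insert i B) ≤ L + s B)
    (F3 : ∀ i B, i ∉ B → s (insert i B) = L + s B → Pr i B)
    (F4 : ∀ i B C, i ∉ B → C ⊆ B → Pr i B → Pr i C)
    (F5 : ∀ i B, i ∉ B → Pr i B → s (insert i B) = L + s B) : False := by
  have small : ∀ B, B.card ≤ 2 → ¬ Γ B := by
    intro B hB hΓ
    obtain ⟨C, hC, hm⟩ := exists_min Γ B hΓ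
    have := Finset.card_le_card hC
    have := h3 C hm
    omega
  have C1 : ∀ A, Γ A → A.card = 3 → ∀ i ∈ A, Pr i (A.erase i) ∧ Pr i Aᶜ := by
    intro A hA hc i hi
    have e1 := F1 (A.erase i) (small _ (by rw [Finset.card_erase_of_mem hi]; omega))
    rw [Finset.compl_erase] at e1
    have e2 := F1 Aᶜ ((hnc A).1 hA)
    rw [compl_compl] at e2
    have e3 := F2 i Aᶜ (by simpa using hi)
    have e4 := F2 i (A.erase i) (by simp)
    rw [Finset.insert_erase hi] at e4
    refine ⟨F3 i _ (by simp) ?_, F3 i _ (by simpa using hi) ?_⟩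
    · rw [Finset.insert_erase hi]; linarith
    · linarith
  have C2 : ∀ i j, i ≠ j → Pr i {j} := by
    intro i j hij
    obtain ⟨A, hA, hi⟩ := hnr i
    obtain ⟨p1, p2⟩ := C1 A hA.1 (h3 A hA) i hi
    by_cases hj : j ∈ A
    · exact F4 i _ _ (by simp) (by simp [hj, hij.symm]) p1
    · exact F4 i _ _ (by simpa using hi) (by simp [hj]) p2
  have S1 : ∀ i, s {i} = L + s ∅ := by
    intro i
    obtain ⟨j, hj⟩ := exists_ne i
    have := F5 i ∅ (by simp) (F4 i _ _ (by simpa using hj.symm) (by simp) (C2 i j hj.symm))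
    simpa using this
  have S2 : ∀ B, B.card = 2 → s B = 2 * L + s ∅ := by
    intro B hB
    obtain ⟨i, j, hij, rfl⟩ := Finset.card_eq_two.1 hB
    rw [F5 i {j} (by simpa using hij) (C2 i j hij), S1]; ring
  have S3 : ∀ A, A.card = 3 → s A ≤ 3 * L + s ∅ := by
    intro A hA
    obtain ⟨i, hi⟩ : A.Nonempty := Finset.card_pos.1 (by omega)
    have h := F2 i (A.erase i) (by simp)
    rw [Finset.insert_erase hi, S2 (A.erase i) (by rw [Finset.card_erase_of_mem hi]; omega)] at h
    linarith
  have C3 : ∀ U, ¬ Γ U → U.card = 3 → ∀ i j, i ∉ U → j ∈ U → Γ (insert i (U.erase j)) := by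
    intro U hU hc i j hi hj
    by_contra hW
    have hUc : Γ Uᶜ := (hnc _).2 (by rwa [compl_compl])
    have hcc : Uᶜ.card = 3 := by rw [Finset.card_compl, hc]; rfl
    have p := (C1 Uᶜ hUc hcc i (by simpa using hi)).2
    rw [compl_compl] at p
    have p' := F4 i U (U.erase j) hi (Finset.erase_subset _ _) p
    have hne : i ∉ U.erase j := fun h => hi (Finset.mem_of_mem_erase h)
    have hce : (U.erase j).card = 2 := by rw [Finset.card_erase_of_mem hj]; omega
    have e1 := F5 i _ hne p'
    rw [S2 _ hce] at e1
    have e2 := F1 _ hW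
    have e3 := S3 (insert i (U.erase j))ᶜ (by
      rw [Finset.card_compl, Finset.card_insert_of_notMem hne, hce]; rfl)
    linarith
  have fin : ∀ a b c d e f : Fin 6, [a, b, c, d, e, f].Nodup → ¬ Γ {a, b, c} →
      ({a, b, c} : Finset (Fin 6)).card = 3 → ({a, e, f} : Finset (Fin 6)).card = 3 →
      ({a, b, c} : Finset (Fin 6)).erase a = {b, c} → ({a, b, c} : Finset (Fin 6)).erase b = {a, c} →
      ({a, e, f} : Finset (Fin 6)).erase a = {e, f} →
      ({d, b, c} : Finset (Fin 6))ᶜ = {a, e, f} → ({d, a, c} : Finset (Fin 6))ᶜ = {b, e, f} →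
      False := by
    intro a b c d e f hnd hU c1 c2 e1 e2 e3 k1 k2
    simp only [List.nodup_cons, List.mem_cons, List.not_mem_nil, not_or] at hnd
    have g1 := C3 _ hU c1 d a (by simp; grind) (by simp)
    rw [e1] at g1
    have g2 := C3 _ hU c1 d b (by simp; grind) (by simp)
    rw [e2] at g2
    have n1 := (hnc _).1 g1
    rw [k1] at n1
    have g3 := C3 _ n1 c2 b a (by simp; grind) (by simp)
    rw [e3] at g3
    have n2 := (hnc _).1 g2
    rw [k2] at n2
    exact n2 g3
  by_cases h : Γ {0, 1, 2}
  · have h' := (hnc _).1 h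
    rw [show ({0, 1, 2} : Finset (Fin 6))ᶜ = {3, 4, 5} by decide] at h'
    exact fin 3 4 5 0 1 2 (by decide) h' (by decide) (by decide) (by decide) (by decide)
      (by decide) (by decide) (by decide)
  · exact fin 0 1 2 3 4 5 (by decide) h (by decide) (by decide) (by decide) (by decide)
      (by decide) (by decide) (by decide)

theorem stmt10 :
    ¬ ∃ (Γ : Finset (Fin 6) → Prop) (ψ : (Fin (6 + 1) → Fin 2) → ℂ),
      Monotonic Γ ∧ NoCloning Γ ∧ NoRedundancy Γ ∧
      (∀ A : Finset (Fin 6), IsMinimal Γ A → A.card = 3) ∧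
      IsPureQSSState Γ ψ := by
  rintro ⟨Γ, ψ, _, hnc, hnr, h3, hq⟩
  have hψ := hq.normalized
  have hc : ∀ A : Finset (Fin 6), Sent ψ (insert 0 (posOf A)) = Sent ψ (posOf Aᶜ) := by
    intro A
    rw [← Sent_compl ψ (posOf Aᶜ), posOf_compl, compl_compl]
  have hR : Sent ψ {0} = Real.log 2 := by
    obtain ⟨A, hA, _⟩ := hnr 0
    have e1 := hq.recover A hA.1
    have e2 := hq.secrecy Aᶜ ((hnc A).1 hA.1)
    rw [hc] at e1 e2
    rw [compl_compl] at e2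
    linarith
  refine comb Γ (fun A => Sent ψ (posOf A)) (Real.log 2) (Real.log_pos one_lt_two)
    (fun i B => Dec ψ i.succ (posOf B)) hnc hnr h3 ?_ ?_ ?_ ?_ ?_
  · intro B hB
    have := hq.secrecy B hB
    rw [hc, hR] at this
    linarith
  · intro i B hi
    simp only [posOf_insert]
    exact Sent_insert_le ψ hψ _ _ (by rwa [mem_posOf])
  · intro i B hi h
    simp only [posOf_insert] at h
    exact Dec_of_eq ψ hψ _ _ (by rwa [mem_posOf]) h
  · intro i B C hi hCB h
    refine Dec_mono ψ i.succ (posOf C) (posOf B) (by rwa [mem_posOf]) ?_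
    rwa [Finset.union_eq_left.2 (show posOf C ⊆ posOf B from Finset.image_subset_image hCB)]
  · intro i B hi h
    simp only [posOf_insert]
    exact Dec_ent ψ hψ _ _ (by rwa [mem_posOf]) h
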